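/- Let Γ be a finitely generated abelian group, M a compact Lie group, and K a closed shift-invariant subgroup of M^Γ. Suppose Δ is a finitely generated abelian group of continuous automorphisms of K whose action commutes with the shift action of Γ on K. If Δ is ergodic on K, then Δ contains an ergodic automorphism: some δ ∈ Δ is ergodic on K. -/

import Mathlib

open MeasureTheory Topology Set

set_option linter.unusedVariables false

namespace ErgZd

variable {K : Type*}

/-- The group of bi-continuous automorphisms of a topological group,
as a subgroup of `MulAut K`. -/
def ContAut (K : Type*) [Group K] [TopologicalSpace K] : Subgroup (MulAut K) where
  carrier := {α | Continuous α ∧ Continuous α.symm}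
  one_mem' := ⟨continuous_id, continuous_id⟩
  mul_mem' := fun {a b} ha hb => ⟨ha.1.comp hb.1, hb.2.comp ha.2⟩
  inv_mem' := fun {a} ha => ⟨ha.2, ha.1⟩

section Defs

variable [Group K] [TopologicalSpace K]

lemma ContAut.continuous (α : ↥(ContAut K)) : Continuous ⇑(α : MulAut K) := α.2.1

lemma ContAut.continuous_symm (α : ↥(ContAut K)) :
    Continuous ⇑(α : MulAut K).symm := α.2.2

/-- Ergodicity of the action of a set `S` of automorphisms with respect to `μ`:
every invariant Borel set is null or conull. -/
def ErgSet [MeasurableSpace K] (μ : Measure K) (S : Set ↥(ContAut K)) : Prop :=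
  ∀ A : Set K, MeasurableSet A → (∀ α ∈ S, (α : MulAut K) '' A = A) → μ A = 0 ∨ μ A = 1

/-- Ergodicity of a single automorphism: ergodicity of the group of its integer powers. -/
def ErgAut [MeasurableSpace K] (μ : Measure K) (α : ↥(ContAut K)) : Prop :=
  ErgSet μ (Set.range fun n : ℤ => α ^ n)

/-- Distality of the action of a set of automorphisms: for `x ≠ 1`, the identity is
not in the closure of the orbit of `x`. -/
def DistalSet (S : Set ↥(ContAut K)) : Prop :=
  ∀ x : K, x ≠ 1 → (1 : K) ∉ closure ((fun α : ↥(ContAut K) => (α : MulAut K) x) '' S)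

/-- Distality of a single automorphism. -/
def DistalAut (α : ↥(ContAut K)) : Prop := DistalSet (Set.range fun n : ℤ => α ^ n)

/-- The descending chain condition for an action: every decreasing
sequence of closed invariant subgroups is eventually constant. -/
def HasDCC (S : Set ↥(ContAut K)) : Prop :=
  ∀ C : ℕ → Subgroup K, (∀ n, IsClosed (C n : Set K)) → (∀ n, C (n + 1) ≤ C n) →
    (∀ n, ∀ α ∈ S, ∀ x, x ∈ C n ↔ (α : MulAut K) x ∈ C n) → ∃ N, ∀ n, N ≤ n → C n = C N

/-- Restriction of an automorphism to an invariant subgroup. -/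
def restrictAut (H : Subgroup K) (α : ↥(ContAut K))
    (h : ∀ x, x ∈ H ↔ (α : MulAut K) x ∈ H) : ↥(ContAut ↥H) := by
  refine ⟨⟨⟨fun x => ⟨(α : MulAut K) x, (h x).mp x.2⟩,
      fun x => ⟨(α : MulAut K).symm x, (h _).mpr (by simpa using x.2)⟩, ?_, ?_⟩, ?_⟩, ?_, ?_⟩
  · intro x; ext; simp
  · intro x; ext; simp
  · intro x y; ext; simp
  · exact Continuous.subtype_mk ((ContAut.continuous α).comp continuous_subtype_val) _
  · exact Continuous.subtype_mk ((ContAut.continuous_symm α).comp continuous_subtype_val) _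

@[simp] lemma restrictAut_coe (H : Subgroup K) (α : ↥(ContAut K))
    (h : ∀ x, x ∈ H ↔ (α : MulAut K) x ∈ H) (x : ↥H) :
    ((((restrictAut H α h) : MulAut ↥H) x : ↥H) : K) = (α : MulAut K) (x : K) := rfl

/-- The automorphism induced on the quotient by an invariant closed normal subgroup. -/
def quotAut (N : Subgroup K) [N.Normal] (α : ↥(ContAut K))
    (h : ∀ x, x ∈ N ↔ (α : MulAut K) x ∈ N) : ↥(ContAut (K ⧸ N)) := by
  have hmap : N.map ((α : MulAut K) : K ≃* K) = N := by
    ext y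
    constructor
    · rintro ⟨x, hx, rfl⟩; exact (h x).mp hx
    · intro hy
      exact ⟨(α : MulAut K).symm y, (h _).mpr (by simpa using hy), by simp⟩
  refine ⟨QuotientGroup.congr N N ((α : MulAut K) : K ≃* K) hmap, ?_, ?_⟩
  · apply (QuotientGroup.isQuotientMap_mk N).continuous_iff.mpr
    have : ⇑(QuotientGroup.congr N N ((α : MulAut K) : K ≃* K) hmap) ∘ (QuotientGroup.mk : K → K ⧸ N)
        = (QuotientGroup.mk : K → K ⧸ N) ∘ ⇑(α : MulAut K) := by
      funext x
      exact QuotientGroup.congr_mk N N _ hmap x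
    rw [this]
    exact QuotientGroup.continuous_mk.comp (ContAut.continuous α)
  · apply (QuotientGroup.isQuotientMap_mk N).continuous_iff.mpr
    have : ⇑(QuotientGroup.congr N N ((α : MulAut K) : K ≃* K) hmap).symm ∘ (QuotientGroup.mk : K → K ⧸ N)
        = (QuotientGroup.mk : K → K ⧸ N) ∘ ⇑((α : MulAut K) : K ≃* K).symm := by
      funext x
      rfl
    rw [this]
    exact QuotientGroup.continuous_mk.comp (ContAut.continuous_symm α)

end Defs

section Shift

/-- The shift automorphism of `M^Γ` given by `γ ∈ Γ`: `(γ • f) β = f (γ⁻¹ * β)`. -/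
def shiftAut (Γ : Type*) [Group Γ] (M : Type*) [Group M] [TopologicalSpace M] (γ : Γ) :
    ↥(ContAut (Γ → M)) := by
  refine ⟨⟨⟨fun f β => f (γ⁻¹ * β), fun f β => f (γ * β), ?_, ?_⟩, ?_⟩, ?_, ?_⟩
  · intro f; funext β; simp
  · intro f; funext β; simp
  · intro f g; rfl
  · exact continuous_pi fun β => continuous_apply _
  · exact continuous_pi fun β => continuous_apply _

end Shift

section InvariantNeighbourhoods

open scoped Pointwise

/-- Every neighbourhood of `N` contains an `S`-invariant open neighbourhood of `N`. When `N` is a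
closed normal subgroup of a compact group, this says that `S` acts equicontinuously on the
quotient by `N`. -/
def HasInvNhds {A G : Type*} [Group A] [TopologicalSpace G] [MulAction A G]
    (S : Subgroup A) (N : Set G) : Prop :=
  ∀ U : Set G, IsOpen U → N ⊆ U →
    ∃ V : Set G, IsOpen V ∧ N ⊆ V ∧ V ⊆ U ∧ S ≤ MulAction.stabilizer A V

namespace HasInvNhds

section Space

variable {A G : Type*} [Group A] [TopologicalSpace G] [MulAction A G] {S T : Subgroup A}
  {N N₁ N₂ : Set G}

lemma anti (h : HasInvNhds T N) (hST : S ≤ T) : HasInvNhds S N := fun U hU hNU => by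
  obtain ⟨V, hV, hNV, hVU, hs⟩ := h U hU hNU
  exact ⟨V, hV, hNV, hVU, hST.trans hs⟩

lemma bot : HasInvNhds (⊥ : Subgroup A) N := fun U hU hNU => ⟨U, hU, hNU, subset_rfl, bot_le⟩

lemma sup [ContinuousConstSMul A G] (hS : HasInvNhds S N) (hT : HasInvNhds T N)
    (hcomm : ∀ s ∈ S, ∀ t ∈ T, s * t = t * s) : HasInvNhds (S ⊔ T) N := fun U hU hNU => by
  obtain ⟨V, hV, hNV, hVU, hVS⟩ := hS U hU hNU
  obtain ⟨W, hW, hNW, hWV, hWT⟩ := hT V hV hNV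
  refine ⟨⋃ s : S, (s : A) • W, isOpen_iUnion fun s => hW.smul _, ?_, ?_, sup_le ?_ ?_⟩
  · exact hNW.trans (subset_iUnion_of_subset 1 (by simp))
  · refine iUnion_subset fun s => ?_
    calc (s : A) • W ⊆ (s : A) • V := smul_set_mono hWV
      _ = V := hVS s.2
      _ ⊆ U := hVU
  · intro s hs
    rw [MulAction.mem_stabilizer_iff, smul_set_iUnion]
    exact (Equiv.mulLeft (⟨s, hs⟩ : S)).iSup_congr fun t => by simp [mul_smul]
  · intro t ht
    rw [MulAction.mem_stabilizer_iff, smul_set_iUnion]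
    refine iUnion_congr fun s => ?_
    rw [← mul_smul, ← hcomm s s.2 t ht, mul_smul, show t • W = W from hWT ht]

lemma smul_of_commute {B : Type*} [Group B] [MulAction B G] [ContinuousConstSMul B G]
    (h : HasInvNhds S N) (b : B) (hb : ∀ s ∈ S, ∀ x : G, s • b • x = b • s • x) :
    HasInvNhds S (b • N) := fun U hU hNU => by
  obtain ⟨V, hV, hNV, hVU, hs⟩ := h (b⁻¹ • U) (hU.smul _) (by
    rwa [subset_smul_set_iff, inv_inv])
  refine ⟨b • V, hV.smul b, smul_set_mono hNV, by rwa [smul_set_subset_iff_subset_inv_smul_set],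
    fun s hsS => ?_⟩
  have h1 : s • b • V = b • s • V := by
    ext x
    simp only [mem_smul_set, exists_exists_and_eq_and, hb s hsS]
  rw [MulAction.mem_stabilizer_iff, h1, show s • V = V from hs hsS]

lemma zpowers_of_pow [ContinuousConstSMul A G] {a : A} {n : ℕ} (hn : 0 < n)
    (hN : a • N = N) (h : HasInvNhds (Subgroup.zpowers (a ^ n)) N) :
    HasInvNhds (Subgroup.zpowers a) N := fun U hU hNU => by
  have hNz : ∀ k : ℤ, a ^ k • N = N := fun k =>
    (Subgroup.zpowers_le.2 (MulAction.mem_stabilizer_iff.2 hN) :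
      Subgroup.zpowers a ≤ MulAction.stabilizer A N) ⟨k, rfl⟩
  obtain ⟨V, hV, hNV, hVU, hs⟩ := h (⋂ i : Fin n, (a ^ (i : ℕ))⁻¹ • U)
    (isOpen_iInter_of_finite fun i => hU.smul _) (subset_iInter fun i => by
      rw [subset_smul_set_iff, inv_inv]
      have := hNz (i : ℕ)
      rw [zpow_natCast] at this
      rwa [this])
  refine ⟨⋃ k : ℤ, a ^ k • V, isOpen_iUnion fun s => hV.smul _, ?_, ?_, ?_⟩
  · exact hNV.trans (subset_iUnion_of_subset 0 (by simp))
  · refine iUnion_subset fun k => ?_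
    have hn' : (n : ℤ) ≠ 0 := by omega
    obtain ⟨i, hi⟩ := Int.eq_ofNat_of_zero_le (Int.emod_nonneg k hn')
    have hin : i < n := by
      have := Int.emod_lt_of_pos k (show (0 : ℤ) < n by omega)
      omega
    have hk : a ^ k • V = a ^ i • V := by
      conv_lhs => rw [← Int.emod_add_mul_ediv k n, hi, zpow_add, mul_smul, zpow_mul, zpow_natCast,
        zpow_natCast]
      congr 1
      exact hs ⟨k / n, rfl⟩
    rw [hk, smul_set_subset_iff_subset_inv_smul_set]
    exact hVU.trans (iInter_subset _ (⟨i, hin⟩ : Fin n))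
  · rw [Subgroup.zpowers_le, MulAction.mem_stabilizer_iff, smul_set_iUnion]
    exact (Equiv.addLeft (1 : ℤ)).iSup_congr fun k => by simp [zpow_add, mul_smul]

lemma inter [NormalSpace G] (h₁ : HasInvNhds S N₁) (h₂ : HasInvNhds S N₂)
    (hc₁ : IsClosed N₁) (hc₂ : IsClosed N₂) : HasInvNhds S (N₁ ∩ N₂) := fun U hU hNU => by
  obtain ⟨U₁, O, hU₁, hO, hNU₁, hNO, hdisj⟩ := normal_separation hc₁ (hc₂.sdiff hU) (by
    rw [Set.disjoint_left]
    exact fun x hx hx' => hx'.2 (hNU ⟨hx, hx'.1⟩))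
  obtain ⟨V₁, hV₁, hNV₁, hVU₁, hs₁⟩ := h₁ U₁ hU₁ hNU₁
  obtain ⟨V₂, hV₂, hNV₂, hVU₂, hs₂⟩ := h₂ (U ∪ O) (hU.union hO) fun x hx => by
    by_cases hxU : x ∈ U
    · exact Or.inl hxU
    · exact Or.inr (hNO ⟨hx, hxU⟩)
  refine ⟨V₁ ∩ V₂, hV₁.inter hV₂, inter_subset_inter hNV₁ hNV₂, ?_, fun s hs => ?_⟩
  · rintro x ⟨hx₁, hx₂⟩
    exact (hVU₂ hx₂).resolve_right (Set.disjoint_left.1 hdisj (hVU₁ hx₁))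
  · rw [MulAction.mem_stabilizer_iff, smul_set_inter, show s • V₁ = V₁ from hs₁ hs,
      show s • V₂ = V₂ from hs₂ hs]

lemma iInter [CompactSpace G] [NormalSpace G] {ι : Type*} {N : ι → Set G}
    (h : ∀ i, HasInvNhds S (N i)) (hc : ∀ i, IsClosed (N i)) : HasInvNhds S (⋂ i, N i) := by
  classical
  intro U hU hNU
  obtain ⟨u, hu⟩ := hU.isClosed_compl.isCompact.elim_finite_subfamily_closed N hc (by
    rw [inter_comm, ← Set.disjoint_iff_inter_eq_empty, Set.disjoint_compl_right_iff_subset]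
    exact hNU)
  have hfin : HasInvNhds S (⋂ i ∈ u, N i) := by
    clear hu
    induction u using Finset.induction_on with
    | empty =>
      intro U hU hNU
      have : U = univ := by simpa using hNU
      exact ⟨U, hU, hNU, subset_rfl, fun s _ => by simp [this]⟩
    | insert i u _ ih =>
      rw [Finset.set_biInter_insert]
      exact (h i).inter ih (hc i) (isClosed_biInter fun j _ => hc j)
  rw [inter_comm, ← Set.disjoint_iff_inter_eq_empty, Set.disjoint_compl_right_iff_subset] at hu
  obtain ⟨V, hV, hNV, hVU, hs⟩ := hfin U hU hu
  exact ⟨V, hV, (iInter_mono fun i => subset_iInter fun _ => subset_rfl).trans hNV, hVU, hs⟩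

end Space

section Group

variable {A G : Type*} [Group A] [Group G] [TopologicalSpace G] [IsTopologicalGroup G]
  [CompactSpace G] [MulDistribMulAction A G] {S : Subgroup A} {N N' L P : Subgroup G}

lemma exists_saturated (h : HasInvNhds S (N : Set G)) (hN' : IsClosed (N' : Set G)) (hle : N ≤ N')
    (hinv : ∀ s ∈ S, s • N' = N') {U : Set G} (hU : IsOpen U) (hNU : (N' : Set G) ⊆ U) :
    ∃ V : Set G, IsOpen V ∧ (N' : Set G) ⊆ V ∧ V ⊆ U ∧ S ≤ MulAction.stabilizer A V ∧
      (N' : Set G) * V = V := by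
  obtain ⟨O, hO, hNO⟩ := compact_open_separated_mul_right hN'.isCompact hU hNU
  have h1 : (1 : G) ∈ interior O := mem_interior_iff_mem_nhds.2 hO
  obtain ⟨V, hV, hNV, hVO, hs⟩ := h (N * interior O) isOpen_interior.mul_left
    fun x hx => ⟨x, hx, 1, h1, mul_one x⟩
  have hN'N : (N' : Set G) * N = N' := by
    refine Subset.antisymm ?_ fun x hx => ⟨x, hx, 1, N.one_mem, mul_one x⟩
    rintro _ ⟨x, hx, y, hy, rfl⟩
    exact N'.mul_mem hx (hle hy)
  refine ⟨N' * V, hV.mul_left, fun x hx => ⟨x, hx, 1, hNV N.one_mem, mul_one x⟩, ?_,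
    fun s hsS => ?_, ?_⟩
  · calc (N' : Set G) * V ⊆ N' * (N * interior O) := mul_subset_mul_left hVO
      _ = N' * interior O := by rw [← mul_assoc, hN'N]
      _ ⊆ N' * O := mul_subset_mul_left interior_subset
      _ ⊆ U := hNO
  · rw [MulAction.mem_stabilizer_iff, smul_mul', show s • V = V from hs hsS,
      ← Subgroup.coe_pointwise_smul, hinv s hsS]
  · rw [← mul_assoc, coe_mul_coe]

lemma mono (h : HasInvNhds S (N : Set G)) (hN' : IsClosed (N' : Set G)) (hle : N ≤ N')
    (hinv : ∀ s ∈ S, s • N' = N') : HasInvNhds S (N' : Set G) := fun U hU hNU => by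
  obtain ⟨V, hV, hNV, hVU, hs, -⟩ := h.exists_saturated hN' hle hinv hU hNU
  exact ⟨V, hV, hNV, hVU, hs⟩

lemma inf_sup [T2Space G] (h : HasInvNhds S (N : Set G)) (hN : IsClosed (N : Set G))
    (hNinv : ∀ s ∈ S, s • N = N) (hL : IsClosed (L : Set G)) (hLinv : ∀ s ∈ S, s • L = L)
    [P.Normal] (hP : IsClosed (P : Set G)) (hPinv : ∀ s ∈ S, s • P = P)
    (htop : P ⊔ L = ⊤) (hLP : P ⊓ L ≤ N) :
    HasInvNhds S ((P ⊔ (N ⊓ L) : Subgroup G) : Set G) := fun U hU hNU => by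
  have hNL : IsCompact ((N ⊓ L : Subgroup G) : Set G) := (hN.inter hL).isCompact
  rw [Subgroup.normal_mul] at hNU ⊢
  obtain ⟨O, hO, hNO⟩ := compact_open_separated_mul_right (hP.isCompact.mul hNL) hU hNU
  have h1 : (1 : G) ∈ interior O := mem_interior_iff_mem_nhds.2 hO
  obtain ⟨W, hW, hNW, hWO, hs, hsat⟩ := h.exists_saturated hN le_rfl hNinv
    (U := ((N ⊓ L : Subgroup G) : Set G) * interior O ∪ (L : Set G)ᶜ)
    (isOpen_interior.mul_left.union hL.isOpen_compl) fun x hx => by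
      by_cases hxL : x ∈ L
      · exact Or.inl ⟨x, ⟨hx, hxL⟩, 1, h1, mul_one x⟩
      · exact Or.inr hxL
  have hcompl : ((P : Set G) * (W ∩ L)) = ((P : Set G) * ((L : Set G) \ W))ᶜ := by
    ext x
    constructor
    · rintro ⟨p, hp, w, ⟨hw, hwL⟩, rfl⟩ ⟨p', hp', l, ⟨hl, hlW⟩, heq⟩
      refine hlW ?_
      rw [← hsat]
      have hlw : l * w⁻¹ = p'⁻¹ * p := by
        rw [eq_inv_mul_iff_mul_eq, ← mul_assoc, mul_inv_eq_iff_eq_mul]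
        exact heq
      exact ⟨l * w⁻¹, hLP ⟨hlw ▸ P.mul_mem (P.inv_mem hp') hp, L.mul_mem hl (L.inv_mem hwL)⟩, w, hw,
        inv_mul_cancel_right l w⟩
    · intro hx
      have hxt : x ∈ ((P ⊔ L : Subgroup G) : Set G) := by simp [htop]
      rw [Subgroup.normal_mul] at hxt
      obtain ⟨p, hp, l, hl, rfl⟩ := hxt
      refine ⟨p, hp, l, ⟨?_, hl⟩, rfl⟩
      by_contra hlW
      exact hx ⟨p, hp, l, ⟨hl, hlW⟩, rfl⟩
  refine ⟨P * (W ∩ L), ?_, ?_, ?_, fun s hsS => ?_⟩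
  · rw [hcompl]
    exact (hP.isCompact.mul (hL.sdiff hW).isCompact).isClosed.isOpen_compl
  · exact mul_subset_mul_left (inter_subset_inter hNW subset_rfl)
  · refine Subset.trans ?_ hNO
    rw [mul_assoc]
    refine mul_subset_mul_left fun x hx => ?_
    exact mul_subset_mul_left interior_subset ((hWO hx.1).resolve_right fun hxL => hxL hx.2)
  · rw [MulAction.mem_stabilizer_iff, smul_mul', smul_set_inter, show s • W = W from hs hsS,
      ← Subgroup.coe_pointwise_smul, ← Subgroup.coe_pointwise_smul, hPinv s hsS, hLinv s hsS]

end Group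

end HasInvNhds

end InvariantNeighbourhoods

section Isolated

/-- A subgroup covered by finitely many subgroups closed under taking roots is contained in one of
them. -/
lemma exists_le_of_subset_biUnion {D : Type*} [Group D] (H : Subgroup D) (s : Finset (Subgroup D))
    (hroot : ∀ T ∈ s, ∀ (a : D) (n : ℕ), 0 < n → a ^ n ∈ T → a ∈ T)
    (hcover : ∀ a ∈ H, ∃ T ∈ s, a ∈ T) : ∃ T ∈ s, H ≤ T := by
  obtain ⟨T, hT, hfin⟩ := Subgroup.exists_finiteIndex_of_leftCoset_cover
    (H := fun T : Subgroup D => T.subgroupOf H) (g := fun _ => 1) (s := s) (by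
      refine eq_univ_of_forall fun a => ?_
      obtain ⟨T, hT, ha⟩ := hcover a a.2
      exact mem_iUnion₂.2 ⟨T, hT, by simpa using Subgroup.mem_subgroupOf.2 ha⟩)
  refine ⟨T, hT, fun a ha => ?_⟩
  obtain ⟨n, hn, -, hmem⟩ := Subgroup.exists_pow_mem_of_index_ne_zero hfin.index_ne_zero
    (⟨a, ha⟩ : H)
  exact hroot T hT a n hn (Subgroup.mem_subgroupOf.1 hmem)

lemma wellFoundedGT_subgroup_of_fg {D : Type*} [Group D] [hfg : Group.FG D]
    (hcomm : ∀ a b : D, a * b = b * a) : WellFoundedGT (Subgroup D) := by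
  let _ : CommGroup D := { ‹Group D› with mul_comm := hcomm }
  have : Module.Finite ℤ (Additive D) := Module.Finite.iff_addGroup_fg.2 inferInstance
  have : WellFoundedGT (Submodule ℤ (Additive D)) := inferInstance
  let e : Subgroup D ≃o Submodule ℤ (Additive D) :=
    Subgroup.toAddSubgroup.trans AddSubgroup.toIntSubmodule
  exact e.strictMono.wellFoundedGT

end Isolated

section ErgodicElement

open scoped Pointwise

variable (D Z : Type*) {G : Type*} [Group D] [Group Z] [Group G] [TopologicalSpace G]
  [MulDistribMulAction D G] [MulDistribMulAction Z G]

/-- A closed normal subgroup invariant under the actions of `D` and `Z`. -/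
structure ClosedInvariant (N : Subgroup G) : Prop where
  isClosed : IsClosed (N : Set G)
  normal : N.Normal
  smul_left : ∀ d : D, d • N = N
  smul_right : ∀ z : Z, z • N = N

variable {D Z}

namespace ClosedInvariant

variable {N L P : Subgroup G}

lemma top : ClosedInvariant D Z (⊤ : Subgroup G) :=
  ⟨isClosed_univ, inferInstance, fun d => by simp [SetLike.ext'_iff],
    fun z => by simp [SetLike.ext'_iff]⟩

lemma inf (hL : ClosedInvariant D Z L) (hP : ClosedInvariant D Z P) :
    ClosedInvariant D Z (L ⊓ P) :=
  have := hL.normal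
  have := hP.normal
  ⟨hL.isClosed.inter hP.isClosed, inferInstance,
    fun d => by rw [Subgroup.smul_inf, hL.smul_left, hP.smul_left],
    fun z => by rw [Subgroup.smul_inf, hL.smul_right, hP.smul_right]⟩

lemma sup [IsTopologicalGroup G] [CompactSpace G] [T2Space G] (hL : ClosedInvariant D Z L)
    (hP : ClosedInvariant D Z P) : ClosedInvariant D Z (L ⊔ P) :=
  have := hL.normal
  have := hP.normal
  ⟨by rw [Subgroup.normal_mul]; exact (hL.isClosed.isCompact.mul hP.isClosed.isCompact).isClosed,
    inferInstance,
    fun d => by rw [Subgroup.smul_sup, hL.smul_left, hP.smul_left],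
    fun z => by rw [Subgroup.smul_sup, hL.smul_right, hP.smul_right]⟩

end ClosedInvariant

/-- The elements of `D` acting equicontinuously on the quotient by `N`. -/
def equicontinuousSubgroup [ContinuousConstSMul D G] (hcomm : ∀ a b : D, a * b = b * a)
    (N : Subgroup G) : Subgroup D where
  carrier := {a | HasInvNhds (Subgroup.zpowers a) (N : Set G)}
  one_mem' := by
    rw [mem_ofPred_eq, Subgroup.zpowers_one_eq_bot]
    exact .bot
  mul_mem' := fun {a b} ha hb => (HasInvNhds.sup ha hb fun s _ t _ => hcomm s t).anti <| by
    rw [Subgroup.zpowers_le]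
    exact Subgroup.mul_mem_sup (Subgroup.mem_zpowers a) (Subgroup.mem_zpowers b)
  inv_mem' := fun {a} ha => by rwa [mem_ofPred_eq, Subgroup.zpowers_inv]

variable [ContinuousConstSMul D G] {hcomm : ∀ a b : D, a * b = b * a}

lemma mem_equicontinuousSubgroup {N : Subgroup G} {a : D} :
    a ∈ equicontinuousSubgroup hcomm N ↔ HasInvNhds (Subgroup.zpowers a) (N : Set G) :=
  Iff.rfl

lemma hasInvNhds_top_of_equicontinuousSubgroup_eq_top [hfg : Group.FG D] {N : Subgroup G}
    (h : equicontinuousSubgroup hcomm N = ⊤) : HasInvNhds (⊤ : Subgroup D) (N : Set G) := by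
  classical
  obtain ⟨s, hs⟩ := Group.fg_def.1 hfg
  rw [← hs]
  clear hs
  induction s using Finset.induction_on with
  | empty => simpa using HasInvNhds.bot
  | insert a s _ ih =>
    rw [Finset.coe_insert, Set.insert_eq, Subgroup.closure_union, ← Subgroup.zpowers_eq_closure]
    refine HasInvNhds.sup ?_ ih fun s _ t _ => hcomm s t
    exact mem_equicontinuousSubgroup.1 (h ▸ Subgroup.mem_top a)

variable [IsTopologicalGroup G] [CompactSpace G] [T2Space G]

/-- The subgroups `N` in the family `N : ι → Subgroup G` give quotients whose groups of
equicontinuous elements are pairwise incomparable and maximal. Any `a` outside of these groups acts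
on the quotient by a finite intersection without nontrivial equicontinuous factor. -/
lemma eq_top_of_hasInvNhds_of_iInf_le {ι : Type*} {N : ι → Subgroup G}
    (hN : ∀ i, ClosedInvariant D Z (N i))
    (hmax : ∀ i, ∀ N' : Subgroup G, ClosedInvariant D Z N' → N' ≠ ⊤ →
      equicontinuousSubgroup hcomm (N i) ≤ equicontinuousSubgroup hcomm N' →
      equicontinuousSubgroup hcomm N' ≤ equicontinuousSubgroup hcomm (N i))
    (hincomp : ∀ i j, equicontinuousSubgroup hcomm (N i) ≤ equicontinuousSubgroup hcomm (N j) →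
      i = j)
    (s : Finset ι) :
    ClosedInvariant D Z (s.inf N) ∧ (∀ i ∉ s, N i ⊔ s.inf N = ⊤) ∧
    ∀ a : D, (∀ i ∈ s, a ∉ equicontinuousSubgroup hcomm (N i)) →
      ∀ N' : Subgroup G, ClosedInvariant D Z N' → s.inf N ≤ N' →
        HasInvNhds (Subgroup.zpowers a) (N' : Set G) → N' = ⊤ := by
  classical
  have hroot : ∀ i, ∀ (a : D) (n : ℕ), 0 < n → a ^ n ∈ equicontinuousSubgroup hcomm (N i) →
      a ∈ equicontinuousSubgroup hcomm (N i) := fun i a n hn ha =>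
    HasInvNhds.zpowers_of_pow hn
      (by rw [← Subgroup.coe_pointwise_smul, (hN i).smul_left]) ha
  have hmono : ∀ {L L' : Subgroup G}, L ≤ L' → ClosedInvariant D Z L' →
      equicontinuousSubgroup hcomm L ≤ equicontinuousSubgroup hcomm L' :=
    fun hle hL' a ha => HasInvNhds.mono ha hL'.isClosed hle fun d _ => hL'.smul_left d
  have hsingle : ∀ i, ∀ a : D, a ∉ equicontinuousSubgroup hcomm (N i) →
      ∀ N' : Subgroup G, ClosedInvariant D Z N' → N i ≤ N' →
        HasInvNhds (Subgroup.zpowers a) (N' : Set G) → N' = ⊤ := by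
    intro i a ha N' hN' hle hinv
    by_contra hne
    exact ha (hmax i N' hN' hne (hmono hle hN') hinv)
  -- complementarity follows from the last property, as some element is outside of the groups in `s`
  have hcompl : ∀ s : Finset ι, ClosedInvariant D Z (s.inf N) →
      (∀ a : D, (∀ i ∈ s, a ∉ equicontinuousSubgroup hcomm (N i)) →
      ∀ N' : Subgroup G, ClosedInvariant D Z N' → s.inf N ≤ N' →
        HasInvNhds (Subgroup.zpowers a) (N' : Set G) → N' = ⊤) →
      ∀ i ∉ s, N i ⊔ s.inf N = ⊤ := by
    intro s hclosed h i hi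
    obtain ⟨b, hb, hbs⟩ : ∃ b ∈ equicontinuousSubgroup hcomm (N i),
        ∀ j ∈ s, b ∉ equicontinuousSubgroup hcomm (N j) := by
      by_contra! hcon
      obtain ⟨T, hT, hle⟩ := exists_le_of_subset_biUnion (equicontinuousSubgroup hcomm (N i))
        (s.image fun j => equicontinuousSubgroup hcomm (N j)) (by
          intro T hT
          obtain ⟨j, -, rfl⟩ := Finset.mem_image.1 hT
          exact hroot j) (fun a ha => by
          obtain ⟨j, hj, haj⟩ := hcon a ha
          exact ⟨_, Finset.mem_image_of_mem _ hj, haj⟩)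
      obtain ⟨j, hj, rfl⟩ := Finset.mem_image.1 hT
      exact hi (hincomp i j hle ▸ hj)
    have hsup := (hN i).sup hclosed
    exact h b hbs _ hsup le_sup_right (hmono le_sup_left hsup hb)
  suffices h : ClosedInvariant D Z (s.inf N) ∧
      ∀ a : D, (∀ i ∈ s, a ∉ equicontinuousSubgroup hcomm (N i)) →
      ∀ N' : Subgroup G, ClosedInvariant D Z N' → s.inf N ≤ N' →
        HasInvNhds (Subgroup.zpowers a) (N' : Set G) → N' = ⊤ from
    ⟨h.1, hcompl s h.1 h.2, h.2⟩
  induction s using Finset.induction_on with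
  | empty => exact ⟨.top, fun a _ N' _ hle _ => top_le_iff.1 hle⟩
  | insert i s hi ih =>
    obtain ⟨hP, hs⟩ := ih
    rw [Finset.inf_insert]
    refine ⟨(hN i).inf hP, fun a ha N' hN' hle hinv => ?_⟩
    have hLP := hcompl s hP hs i hi
    -- a factor `L` of the product decomposition is contained in `N'`
    have key : ∀ L P : Subgroup G, ClosedInvariant D Z L → ClosedInvariant D Z P → P ⊔ L = ⊤ →
        P ⊓ L ≤ N' → (∀ Q : Subgroup G, ClosedInvariant D Z Q → P ≤ Q →
          HasInvNhds (Subgroup.zpowers a) (Q : Set G) → Q = ⊤) → L ≤ N' := by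
      intro L P hL hP htop hle hQ l hl
      have := hP.normal
      have hlt : l ∈ ((P ⊔ (N' ⊓ L) : Subgroup G) : Set G) := by
        rw [hQ _ (hP.sup (hN'.inf hL)) le_sup_left (hinv.inf_sup hN'.isClosed
          (fun d _ => hN'.smul_left d) hL.isClosed (fun d _ => hL.smul_left d) hP.isClosed
          (fun d _ => hP.smul_left d) htop hle)]
        trivial
      rw [Subgroup.normal_mul] at hlt
      obtain ⟨p, hp, n, hn, rfl⟩ := hlt
      refine N'.mul_mem (hle ⟨hp, ?_⟩) hn.1
      simpa using L.mul_mem hl (L.inv_mem hn.2)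
    rw [eq_top_iff, ← hLP]
    refine sup_le ?_ ?_
    · exact key _ _ (hN i) hP (by rwa [sup_comm]) (by rwa [inf_comm]) fun Q hQ hle' hQinv =>
        hs a (fun j hj => ha j (Finset.mem_insert_of_mem hj)) Q hQ hle' hQinv
    · exact key _ _ hP (hN i) hLP hle fun Q hQ hle' hQinv =>
        hsingle i a (ha i (Finset.mem_insert_self i s)) Q hQ hle' hQinv

/-- If `D` has no nontrivial equicontinuous factor, the same is true for some element of `D`. -/
theorem exists_zpowers_eq_top_of_hasInvNhds [Group.FG D] (hcomm : ∀ a b : D, a * b = b * a)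
    (hdcc : ∀ C : ℕ → Subgroup G, (∀ n, ClosedInvariant D Z (C n)) → Antitone C →
      ∃ n, C (n + 1) = C n)
    (htop : ∀ N : Subgroup G, ClosedInvariant D Z N → HasInvNhds (⊤ : Subgroup D) (N : Set G) →
      N = ⊤) :
    ∃ a : D, ∀ N : Subgroup G, ClosedInvariant D Z N →
      HasInvNhds (Subgroup.zpowers a) (N : Set G) → N = ⊤ := by
  classical
  by_contra! hcon
  have hwf := wellFoundedGT_subgroup_of_fg hcomm
  let F : Set (Subgroup D) :=
    {T | ∃ N : Subgroup G, ClosedInvariant D Z N ∧ N ≠ ⊤ ∧ equicontinuousSubgroup hcomm N = T}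
  let I : Set (Subgroup D) := {T | Maximal (· ∈ F) T}
  have hI : ∀ T : I, ∃ N : Subgroup G, ClosedInvariant D Z N ∧ N ≠ ⊤ ∧
      equicontinuousSubgroup hcomm N = T := fun T => T.2.1
  choose N hN hNtop hNT using hI
  have hbase := eq_top_of_hasInvNhds_of_iInf_le (hcomm := hcomm) hN
    (fun T N' hN' hne hle => by
      rw [hNT] at hle ⊢
      exact T.2.2 ⟨N', hN', hne, rfl⟩ hle)
    (fun T T' hle => by
      rw [hNT, hNT] at hle
      exact Subtype.ext (le_antisymm hle (T.2.2 T'.2.1 hle)))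
  have hfin : I.Finite := by
    by_contra hinf
    let t : ℕ ↪ I := Set.Infinite.natEmbedding I hinf
    obtain ⟨n, hn⟩ := hdcc (fun n => ((Finset.range n).map t).inf N) (fun n => (hbase _).1)
      fun m n hmn => Finset.inf_mono (Finset.map_subset_map.2 (Finset.range_mono hmn))
    have h1 := (hbase ((Finset.range n).map t)).2.1 (t n) (by simp)
    refine hNtop (t n) ?_
    rw [← h1, left_eq_sup, ← hn]
    exact Finset.inf_le (by simp)
  obtain ⟨T, hT, hle⟩ := exists_le_of_subset_biUnion ⊤ hfin.toFinset
    (fun T hT a n hn ha => by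
      have hT' : T ∈ I := hfin.mem_toFinset.1 hT
      obtain ⟨N, hN, -, rfl⟩ := hT'.1
      exact HasInvNhds.zpowers_of_pow hn
        (by rw [← Subgroup.coe_pointwise_smul, hN.smul_left]) ha)
    (fun a _ => by
      obtain ⟨N, hN, hinv, hne⟩ := hcon a
      obtain ⟨T, hle, hT⟩ := exists_maximal_ge_of_wellFoundedGT (· ∈ F)
        (equicontinuousSubgroup hcomm N) ⟨N, hN, hne, rfl⟩
      exact ⟨T, hfin.mem_toFinset.2 hT, hle hinv⟩)
  have hT' : T ∈ I := hfin.mem_toFinset.1 hT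
  obtain ⟨N, hN, hne, rfl⟩ := hT'.1
  exact hne (htop N hN (hasInvNhds_top_of_equicontinuousSubgroup_eq_top (top_le_iff.1 hle)))

end ErgodicElement

section CompactLinearGroup

/-- Invariant mean on the continuous functions on a compact group. -/
lemma exists_invariant_mean (H : Type*) [Group H] [TopologicalSpace H] [IsTopologicalGroup H]
    [CompactSpace H] : ∃ l : C(H, ℝ) →ₗ[ℝ] ℝ, (∀ f, |l f| ≤ ‖f‖) ∧ l 1 = 1 ∧
      ∀ (a : H) (f g : C(H, ℝ)), (∀ h, g h = f (a * h)) → l g = l f := by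
  borelize H
  let μ : Measure H := Measure.haarMeasure ⊤
  have : IsProbabilityMeasure μ := ⟨by
    simpa using Measure.haarMeasure_self (K₀ := (⊤ : TopologicalSpace.PositiveCompacts H))⟩
  have hint : ∀ f : C(H, ℝ), Integrable f μ := fun f =>
    f.continuous.integrable_of_hasCompactSupport (.of_compactSpace _)
  refine ⟨{ toFun := fun f => ∫ h, f h ∂μ
            map_add' := fun f g => integral_add (hint f) (hint g)
            map_smul' := fun c f => integral_const_mul c _ }, fun f => ?_, ?_, fun a f g hg => ?_⟩
  · simpa using norm_integral_le_of_norm_le_const (μ := μ) (.of_forall f.norm_coe_le_norm)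
  · simp
  · simp only [LinearMap.coe_mk, AddHom.coe_mk, hg]
    exact integral_mul_left_eq_self f a

variable {M : Type*} [Group M] [TopologicalSpace M] {n : Type*} [Fintype n] [DecidableEq n]
  (ρ : M →* Matrix n n ℝ)

/-- The value at `x` of a polynomial in the matrix entries of `ρ`. -/
noncomputable def entryEval (x : M) : MvPolynomial (n × n) ℝ →ₐ[ℝ] ℝ :=
  MvPolynomial.aeval fun ij => ρ x ij.1 ij.2

/-- Right translates of a polynomial in the entries of `ρ`, averaged by a linear functional on the
continuous functions on `H`, are polynomials. -/
lemma exists_entryEval_eq_mean (hρ : Continuous ρ) (H : Subgroup M) (l : C(H, ℝ) →ₗ[ℝ] ℝ)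
    (p : MvPolynomial (n × n) ℝ) (f : M → C(H, ℝ)) (hf : ∀ x h, f x h = entryEval ρ (x * h) p) :
    ∃ q : MvPolynomial (n × n) ℝ, ∀ x, entryEval ρ x q = l (f x) := by
  let c : n → n → C(H, ℝ) := fun i j => ⟨fun h => ρ h i j, by fun_prop⟩
  let Q : MvPolynomial (n × n) C(H, ℝ) :=
    MvPolynomial.aeval (fun ij => ∑ k, MvPolynomial.X (ij.1, k) * MvPolynomial.C (c k ij.2)) p
  let r : M → n × n → ℝ := fun x ij => ρ x ij.1 ij.2
  have hQ : ∀ x, f x = ∑ m ∈ Q.support, (∏ ij ∈ m.support, r x ij ^ m ij) • Q.coeff m := by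
    intro x
    ext h
    have h1 : ∀ p, MvPolynomial.eval₂Hom (ContinuousMap.evalAlgHom ℝ ℝ h : C(H, ℝ) →+* ℝ) (r x)
        (MvPolynomial.aeval
          (fun ij => ∑ k, MvPolynomial.X (ij.1, k) * MvPolynomial.C (c k ij.2)) p) =
        entryEval ρ (x * h) p := by
      intro p
      induction p using MvPolynomial.induction_on with
      | C a =>
        rw [MvPolynomial.aeval_C, IsScalarTower.algebraMap_apply ℝ C(H, ℝ),
          MvPolynomial.algebraMap_eq]
        simp [entryEval]
      | add p q hp hq => simp only [map_add, hp, hq]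
      | mul_X p ij hp =>
        rw [map_mul, map_mul, hp, map_mul]
        simp [entryEval, r, c, Matrix.mul_apply]
    rw [hf, ← h1, MvPolynomial.coe_eval₂Hom, MvPolynomial.eval₂_eq]
    simp [Q, mul_comm]
  refine ⟨∑ m ∈ Q.support, MvPolynomial.C (l (Q.coeff m)) *
    ∏ ij ∈ m.support, MvPolynomial.X ij ^ m ij, fun x => ?_⟩
  rw [hQ]
  simp only [entryEval, r, map_sum, map_mul, map_prod, map_pow, map_smul, smul_eq_mul,
    MvPolynomial.aeval_X, MvPolynomial.aeval_C, Algebra.algebraMap_self, RingHom.id_apply, mul_comm]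

variable [IsTopologicalGroup M] [CompactSpace M] [T2Space M]

lemma exists_entryEval_separating (hρ : Continuous ρ) (hinj : Function.Injective ρ)
    (H : Subgroup M) (hH : IsClosed (H : Set M)) {u : M} (hu : u ∉ H) :
    ∃ q : MvPolynomial (n × n) ℝ, (∀ h ∈ H, entryEval ρ h q = 0) ∧ entryEval ρ u q ≠ 0 := by
  have : CompactSpace H := isCompact_iff_compactSpace.1 hH.isCompact
  let e : n × n → C(M, ℝ) := fun ij => ⟨fun x => ρ x ij.1 ij.2, by fun_prop⟩
  have he : ∀ (p : MvPolynomial (n × n) ℝ) (x : M),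
      MvPolynomial.aeval e p x = entryEval ρ x p := by
    intro p x
    have : (ContinuousMap.evalAlgHom ℝ ℝ x).comp (MvPolynomial.aeval e) = entryEval ρ x :=
      MvPolynomial.algHom_ext fun ij => by simp [entryEval, e]
    exact DFunLike.congr_fun this p
  obtain ⟨φ, hφH, hφu, -⟩ := exists_continuous_zero_one_of_isClosed hH
    (hH.preimage (continuous_const_mul u⁻¹)) (by
      rw [Set.disjoint_left]
      intro x hx hx'
      refine hu ?_
      simpa using H.mul_mem hx (H.inv_mem hx'))
  obtain ⟨⟨_, p, rfl⟩, hp⟩ :=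
    ContinuousMap.exists_mem_subalgebra_near_continuousMap_of_separatesPoints
      (MvPolynomial.aeval e : MvPolynomial (n × n) ℝ →ₐ[ℝ] C(M, ℝ)).range (fun x y hxy => by
        obtain ⟨i, j, hij⟩ : ∃ i j, ρ x i j ≠ ρ y i j := by
          by_contra! hcon
          exact hxy (hinj (Matrix.ext hcon))
        exact ⟨_, ⟨e (i, j), ⟨MvPolynomial.X (i, j), by simp⟩, rfl⟩, hij⟩) φ (1 / 4) (by norm_num)
  have hclose : ∀ x, |entryEval ρ x p - φ x| < 1 / 4 := fun x => by
    rw [← he]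
    exact (ContinuousMap.norm_coe_le_norm (MvPolynomial.aeval e p - φ) x).trans_lt hp
  obtain ⟨l, hl, hl1, hlinv⟩ := exists_invariant_mean H
  let f : M → C(H, ℝ) := fun x => (MvPolynomial.aeval e p).comp ⟨fun h => x * h, by fun_prop⟩
  have hf : ∀ x h, f x h = entryEval ρ (x * h) p := fun x h => he p _
  obtain ⟨q, hq⟩ := exists_entryEval_eq_mean ρ hρ H l p f hf
  have hone : |l (f 1)| ≤ 1 / 4 := by
    refine (hl _).trans ((ContinuousMap.norm_le _ (by norm_num)).2 fun h => ?_)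
    have := hclose h
    rw [hφH h.2] at this
    rw [hf, one_mul]
    simpa using this.le
  have hfu : |l (f u) - 1| ≤ 1 / 4 := by
    have hsub : l (f u) - 1 = l (f u - 1) := by rw [map_sub, hl1]
    rw [hsub]
    refine (hl _).trans ((ContinuousMap.norm_le _ (by norm_num)).2 fun h => ?_)
    have := hclose (u * h)
    rw [hφu (show u⁻¹ * (u * h) ∈ (H : Set M) by simp)] at this
    rw [ContinuousMap.sub_apply, hf]
    simpa using this.le
  refine ⟨q - MvPolynomial.C (l (f 1)), fun h hh => ?_, ?_⟩
  · rw [map_sub, hq, hlinv ⟨h, hh⟩ (f 1) (f h) fun k => by simp [hf]]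
    simp [entryEval]
  · rw [map_sub, hq]
    simp only [entryEval, MvPolynomial.aeval_C, Algebra.algebraMap_self, RingHom.id_apply]
    rw [abs_le] at hone hfu
    intro h
    linarith [hone.2, hfu.1]

/-- Closed subgroups of a compact real linear group satisfy the descending chain condition. -/
lemma closedSubgroup_dcc (hρ : Continuous ρ) (hinj : Function.Injective ρ)
    (C : ℕ → Subgroup M) (hC : ∀ k, IsClosed (C k : Set M)) (hanti : Antitone C) :
    ∃ N, ∀ k, N ≤ k → C k = C N := by
  let I : ℕ →o Ideal (MvPolynomial (n × n) ℝ) :=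
    { toFun := fun k => ⨅ h : C k, RingHom.ker (entryEval ρ (h : M))
      monotone' := fun a b hab => le_iInf fun h => iInf_le_of_le ⟨h, hanti hab h.2⟩ le_rfl }
  obtain ⟨N, hN⟩ := monotone_stabilizes_iff_noetherian.2 inferInstance I
  refine ⟨N, fun k hk => le_antisymm (hanti hk) fun u hu => ?_⟩
  by_contra hcon
  obtain ⟨q, hq, hqu⟩ := exists_entryEval_separating ρ hρ hinj (C k) (hC k) hcon
  have hI : ∀ k, q ∈ I k ↔ ∀ h ∈ C k, entryEval ρ h q = 0 := fun k =>
    (Submodule.mem_iInf _).trans ⟨fun h x hx => h ⟨x, hx⟩, fun h x => h x x.2⟩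
  exact hqu ((hI N).1 (hN k hk ▸ (hI k).2 hq) u hu)

/-- A faithful unitary representation gives a faithful real representation. -/
lemma exists_real_representation {M : Type*} [Group M] [TopologicalSpace M] {k : ℕ}
    (φ : M →* Matrix.unitaryGroup (Fin k) ℂ) (hφ : Continuous φ) (hinj : Function.Injective φ) :
    ∃ ρ : M →* Matrix (Fin k ⊕ Fin k) (Fin k ⊕ Fin k) ℝ, Continuous ρ ∧ Function.Injective ρ := by
  let R : Matrix (Fin k) (Fin k) ℂ → Matrix (Fin k ⊕ Fin k) (Fin k ⊕ Fin k) ℝ := fun a =>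
    Matrix.fromBlocks (a.map Complex.re) (-a.map Complex.im) (a.map Complex.im) (a.map Complex.re)
  have hR : Function.Injective R := fun a b hab => by
    rw [Matrix.fromBlocks_inj] at hab
    ext i j
    exact Complex.ext (congr_fun₂ hab.1 i j) (congr_fun₂ hab.2.2.1 i j)
  refine ⟨{ toFun := fun x => R (φ x : Matrix (Fin k) (Fin k) ℂ)
            map_one' := ?_
            map_mul' := fun x y => ?_ }, ?_, ?_⟩
  · simp only [R, map_one, OneMemClass.coe_one]
    rw [← Matrix.fromBlocks_one]
    congr 1 <;> ext i j <;> by_cases hij : i = j <;> simp [hij, Matrix.one_apply]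
  · simp only [R, map_mul, MulMemClass.coe_mul, Matrix.fromBlocks_multiply]
    congr 1 <;> ext i j <;>
      simp [Matrix.mul_apply, Finset.sum_add_distrib, sub_eq_add_neg, add_comm]
  · have : Continuous fun x => (φ x : Matrix (Fin k) (Fin k) ℂ) := continuous_subtype_val.comp hφ
    exact Continuous.matrix_fromBlocks (this.matrix_map Complex.continuous_re)
      (this.matrix_map Complex.continuous_im).neg (this.matrix_map Complex.continuous_im)
      (this.matrix_map Complex.continuous_re)
  · exact hR.comp (Subtype.val_injective.comp hinj)

end CompactLinearGroup

section ShiftChains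

/-- The descending chain condition for closed shift-invariant subgroups of `Γ → M`. -/
def ShiftDCC (Γ M : Type*) [Group Γ] [Group M] [TopologicalSpace M] : Prop :=
  ∀ C : ℕ → Subgroup (Γ → M), (∀ n, IsClosed (C n : Set (Γ → M))) → Antitone C →
    (∀ n γ, ∀ f ∈ C n, (fun β => f (γ * β)) ∈ C n) → ∃ N, ∀ n, N ≤ n → C n = C N

/-- A doubly antitone family satisfying a chain condition is eventually constant in the first
index, uniformly in the second. -/
lemma exists_stable_of_antitone₂ {X : Type*} [PartialOrder X] (p : X → Prop)
    (hp : ∀ C : ℕ → X, (∀ n, p (C n)) → Antitone C → ∃ N, ∀ n, N ≤ n → C n = C N)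
    (F : ℕ → ℕ → X) (hF : ∀ k n, p (F k n))
    (hanti : ∀ k k' n n', k ≤ k' → n ≤ n' → F k' n' ≤ F k n) :
    ∃ N, ∀ k, N ≤ k → ∀ n, F k n = F N n := by
  obtain ⟨J, hJ⟩ := hp (fun n => F n n) (fun n => hF n n) fun m n h => hanti _ _ _ _ h h
  choose N hN using fun n => hp (fun k => F k n) (fun k => hF k n)
    fun k k' h => hanti _ _ _ _ h le_rfl
  have hlarge : ∀ k n, J ≤ k → J ≤ n → F k n = F J J := fun k n hk hn =>
    le_antisymm (hanti _ _ _ _ hk hn) (by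
      rw [← hJ (max k n) (le_max_of_le_left hk)]
      exact hanti _ _ _ _ (le_max_left _ _) (le_max_right _ _))
  refine ⟨max J ((Finset.range J).sup N), fun k hk n => ?_⟩
  have hk' := max_le_iff.1 hk
  rcases le_or_gt J n with hn | hn
  · rw [hlarge k n hk'.1 hn, hlarge _ n (le_max_left _ _) hn]
  · have hle : N n ≤ (Finset.range J).sup N := Finset.le_sup (Finset.mem_range.2 hn)
    exact (hN n k (hle.trans hk'.2)).trans (hN n _ (hle.trans (le_max_right _ _))).symm

variable {Γ Γ' M : Type*} [CommGroup Γ] [CommGroup Γ'] [Group M]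

/-- Restrictions along `φ` of the elements of `H` which are trivial on the first `n` translates of
the range of `φ` by positive powers of `t`. -/
def leadingSubgroup (φ : Γ →* Γ') (t : Γ') (H : Subgroup (Γ' → M)) (n : ℕ) : Subgroup (Γ → M) where
  carrier := {g | ∃ h ∈ H, (∀ γ, h (φ γ) = g γ) ∧ ∀ i, i < n → ∀ γ, h (t ^ (i + 1) * φ γ) = 1}
  one_mem' := ⟨1, H.one_mem, fun _ => rfl, fun _ _ _ => rfl⟩
  mul_mem' := by
    rintro g g' ⟨h, hH, hg, h1⟩ ⟨h', hH', hg', h1'⟩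
    exact ⟨h * h', H.mul_mem hH hH', fun γ => by simp [hg, hg'],
      fun i hi γ => by simp [h1 i hi, h1' i hi]⟩
  inv_mem' := by
    rintro g ⟨h, hH, hg, h1⟩
    exact ⟨h⁻¹, H.inv_mem hH, fun γ => by simp [hg], fun i hi γ => by simp [h1 i hi]⟩

lemma mem_leadingSubgroup {φ : Γ →* Γ'} {t : Γ'} {H : Subgroup (Γ' → M)} {n : ℕ} {g : Γ → M} :
    g ∈ leadingSubgroup φ t H n ↔
      ∃ h ∈ H, (∀ γ, h (φ γ) = g γ) ∧ ∀ i, i < n → ∀ γ, h (t ^ (i + 1) * φ γ) = 1 :=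
  Iff.rfl

lemma leadingSubgroup_anti (φ : Γ →* Γ') (t : Γ') {H H' : Subgroup (Γ' → M)} (hH : H' ≤ H)
    {n n' : ℕ} (hn : n ≤ n') : leadingSubgroup φ t H' n' ≤ leadingSubgroup φ t H n := by
  rintro g ⟨h, hh, hg, h1⟩
  exact ⟨h, hH hh, hg, fun i hi => h1 i (hi.trans_le hn)⟩

variable [TopologicalSpace M]

lemma isClosed_leadingSubgroup [CompactSpace M] [T2Space M] (φ : Γ →* Γ') (t : Γ')
    {H : Subgroup (Γ' → M)} (hH : IsClosed (H : Set (Γ' → M))) (n : ℕ) :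
    IsClosed (leadingSubgroup φ t H n : Set (Γ → M)) := by
  have hc : IsClosed ((H : Set (Γ' → M)) ∩
      ⋂ (i) (_ : i < n) (γ : Γ), {h | h (t ^ (i + 1) * φ γ) = 1}) :=
    hH.inter <| isClosed_iInter fun i => isClosed_iInter fun _ => isClosed_iInter fun γ =>
      isClosed_eq (continuous_apply _) continuous_const
  have himg : (leadingSubgroup φ t H n : Set (Γ → M)) = (fun h γ => h (φ γ)) ''
      ((H : Set (Γ' → M)) ∩ ⋂ (i) (_ : i < n) (γ : Γ), {h | h (t ^ (i + 1) * φ γ) = 1}) := by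
    ext g
    simp only [SetLike.mem_coe, mem_leadingSubgroup, mem_image, mem_inter_iff, mem_iInter,
      mem_ofPred_eq, funext_iff]
    exact ⟨fun ⟨h, hh, hg, h1⟩ => ⟨h, ⟨hh, h1⟩, hg⟩, fun ⟨h, ⟨hh, h1⟩, hg⟩ => ⟨h, hh, hg, h1⟩⟩
  rw [himg]
  exact (hc.isCompact.image (by fun_prop)).isClosed

lemma le_of_leadingSubgroup_eq {φ : Γ →* Γ'} {t : Γ'} (hgen : ∀ γ', ∃ (i : ℤ) (γ : Γ),
    γ' = t ^ i * φ γ) {H H' : Subgroup (Γ' → M)} (hle : H' ≤ H)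
    (hH' : IsClosed (H' : Set (Γ' → M)))
    (hinv : ∀ γ, ∀ f ∈ H, (fun β => f (γ * β)) ∈ H)
    (hinv' : ∀ γ, ∀ f ∈ H', (fun β => f (γ * β)) ∈ H')
    (heq : ∀ n, leadingSubgroup φ t H n ≤ leadingSubgroup φ t H' n) : H ≤ H' := by
  -- elements of `H` agree with elements of `H'` on finitely many consecutive translates
  have hagree : ∀ n : ℕ, ∀ h ∈ H, ∃ h' ∈ H', ∀ i, i < n → ∀ γ, h (t ^ i * φ γ) =
      h' (t ^ i * φ γ) := by
    intro n
    induction n with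
    | zero => exact fun h _ => ⟨1, H'.one_mem, fun i hi => absurd hi (Nat.not_lt_zero i)⟩
    | succ n ih =>
      intro h hh
      obtain ⟨k, hk, hkh⟩ := ih _ (hinv t h hh)
      have hk' := hinv' t⁻¹ k hk
      obtain ⟨l, hl, hlh, hl1⟩ := mem_leadingSubgroup.1 <| heq n <| mem_leadingSubgroup.2
        ⟨_, H.mul_mem hh (H.inv_mem (hle hk')), fun γ => rfl, fun i hi γ => by
          have := hkh i hi γ
          rw [← mul_assoc, ← pow_succ'] at this
          simp only [Pi.mul_apply, Pi.inv_apply, this]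
          rw [pow_succ' t i, mul_assoc t, inv_mul_cancel_left, mul_inv_cancel]⟩
      refine ⟨l * fun β => k (t⁻¹ * β), H'.mul_mem hl hk', fun i hi γ => ?_⟩
      cases i with
      | zero => simp [hlh]
      | succ i =>
        have := hkh i (by omega) γ
        rw [← mul_assoc, ← pow_succ'] at this
        rw [Pi.mul_apply, hl1 i (by omega), this, one_mul]
        rw [pow_succ' t i, mul_assoc t, inv_mul_cancel_left]
  intro h hh
  rw [← SetLike.mem_coe, ← hH'.closure_eq, mem_closure_iff]
  intro U hU hhU
  obtain ⟨s, u, hu, hsU⟩ := isOpen_pi_iff.1 hU h hhU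
  choose e g heg using hgen
  let N : ℕ := s.sup fun x => (e x).natAbs
  have hN : ∀ x ∈ s, (e x).natAbs ≤ N := fun x hx => Finset.le_sup (f := fun x => (e x).natAbs) hx
  obtain ⟨h', hh', heq'⟩ := hagree (2 * N + 1) _ (hinv (t ^ (-(N : ℤ))) h hh)
  refine ⟨_, hsU fun x hx => ?_, hinv' (t ^ (N : ℤ)) h' hh'⟩
  obtain ⟨j, hj⟩ := Int.eq_ofNat_of_zero_le (a := N + e x) (by have := hN x hx; omega)
  have hx1 : t ^ (N : ℤ) * x = t ^ j * φ (g x) := by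
    conv_lhs => rw [heg x]
    rw [← mul_assoc, ← zpow_add, hj, zpow_natCast]
  have hx2 := heq' j (by have := hN x hx; omega) (g x)
  rw [← hx1, ← mul_assoc, ← zpow_add, neg_add_cancel, zpow_zero, one_mul] at hx2
  rw [← hx2]
  exact (hu x hx).2

lemma ShiftDCC.of_generate [CompactSpace M] [T2Space M] (h : ShiftDCC Γ M) (φ : Γ →* Γ') (t : Γ')
    (hgen : ∀ γ', ∃ (i : ℤ) (γ : Γ), γ' = t ^ i * φ γ) : ShiftDCC Γ' M := by
  intro C hC hanti hinv
  obtain ⟨N, hN⟩ := exists_stable_of_antitone₂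
    (fun H : Subgroup (Γ → M) => IsClosed (H : Set (Γ → M)) ∧
      ∀ γ, ∀ f ∈ H, (fun β => f (γ * β)) ∈ H)
    (fun C hC hanti => h C (fun n => (hC n).1) hanti fun n => (hC n).2)
    (fun k n => leadingSubgroup φ t (C k) n)
    (fun k n => ⟨isClosed_leadingSubgroup φ t (hC k) n, by
      rintro γ f ⟨g, hg, hgf, hg1⟩
      exact ⟨_, hinv k (φ γ) g hg, fun β => by rw [← map_mul, hgf], fun i hi β => by
        rw [mul_left_comm, ← map_mul, hg1 i hi]⟩⟩)
    (fun k k' n n' hk hn => leadingSubgroup_anti φ t (hanti hk) hn)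
  exact ⟨N, fun k hk => le_antisymm (hanti hk) <| le_of_leadingSubgroup_eq hgen (hanti hk) (hC k)
    (hinv N) (hinv k) fun n => (hN k hk n).ge⟩

lemma ShiftDCC.of_subsingleton [Subsingleton Γ] [CompactSpace M] [T2Space M]
    (h : ∀ C : ℕ → Subgroup M, (∀ k, IsClosed (C k : Set M)) → Antitone C →
      ∃ N, ∀ k, N ≤ k → C k = C N) : ShiftDCC Γ M := by
  intro C hC hanti _
  have hinj : Function.Injective (Pi.evalMonoidHom (fun _ : Γ => M) 1) := fun f g hfg =>
    funext fun x => by rw [Subsingleton.elim x 1]; exact hfg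
  obtain ⟨N, hN⟩ := h (fun n => (C n).map (Pi.evalMonoidHom (fun _ : Γ => M) 1))
    (fun n => ((hC n).isCompact.image (continuous_apply (1 : Γ))).isClosed)
    (fun m n hmn => Subgroup.map_mono (hanti hmn))
  exact ⟨N, fun k hk => Subgroup.map_injective hinj (hN k hk)⟩

theorem shiftDCC_of_fg [hfg : Group.FG Γ] [CompactSpace M] [T2Space M]
    (h : ∀ C : ℕ → Subgroup M, (∀ k, IsClosed (C k : Set M)) → Antitone C →
      ∃ N, ∀ k, N ≤ k → C k = C N) : ShiftDCC Γ M := by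
  classical
  obtain ⟨s, hs⟩ := Group.fg_def.1 hfg
  have hsub : ∀ s : Finset Γ, ShiftDCC (Subgroup.closure (s : Set Γ)) M := by
    intro s
    induction s using Finset.induction_on with
    | empty =>
      have : Subsingleton (Subgroup.closure ((∅ : Finset Γ) : Set Γ)) := by
        rw [Finset.coe_empty, Subgroup.closure_empty]
        infer_instance
      exact .of_subsingleton h
    | insert t s _ ih =>
      have hle : Subgroup.closure (s : Set Γ) ≤
          Subgroup.closure ((insert t s : Finset Γ) : Set Γ) :=
        Subgroup.closure_mono (by simp)
      refine ih.of_generate (Subgroup.inclusion hle)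
        ⟨t, Subgroup.subset_closure (by simp)⟩ fun ⟨γ', hγ'⟩ => ?_
      have hmem := hγ'
      rw [Finset.coe_insert, Set.insert_eq, Subgroup.closure_union, Subgroup.mem_sup] at hmem
      obtain ⟨y, hy, z, hz, hyz⟩ := hmem
      obtain ⟨i, rfl⟩ := Subgroup.mem_closure_singleton.1 hy
      exact ⟨i, ⟨z, hz⟩, Subtype.ext hyz.symm⟩
  exact (hsub s).of_generate (Subgroup.subtype _) 1 fun γ => ⟨0, ⟨γ, hs ▸ trivial⟩, by simp⟩

end ShiftChains

section Measure

open scoped Pointwise symmDiff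

lemma hasInvNhds_zeroSet {A G : Type*} [Group A] [TopologicalSpace G] [CompactSpace G]
    [MulAction A G] {S : Subgroup A} {L : G → ℝ} (hL : Continuous L) (h0 : ∀ x, 0 ≤ L x)
    (hinv : ∀ s ∈ S, ∀ x, L (s • x) = L x) : HasInvNhds S {x | L x = 0} := fun U hU hNU => by
  obtain ⟨ε, hε, hεU⟩ : ∃ ε > 0, ∀ x ∈ Uᶜ, ε ≤ L x := by
    obtain hemp | hne := (Uᶜ).eq_empty_or_nonempty
    · exact ⟨1, one_pos, by simp [hemp]⟩
    · obtain ⟨x, hx, hmin⟩ := hU.isClosed_compl.isCompact.exists_isMinOn hne hL.continuousOn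
      exact ⟨L x, (h0 x).lt_of_ne fun h => hx (hNU h.symm), fun y hy => hmin hy⟩
  refine ⟨{x | L x < ε}, isOpen_lt hL continuous_const, fun x hx => ?_, fun x hx => ?_,
    fun s hs => ?_⟩
  · simpa [show L x = 0 from hx] using hε
  · by_contra hxU
    exact (hεU x hxU).not_gt hx
  · rw [MulAction.mem_stabilizer_iff]
    ext x
    rw [Set.mem_smul_set_iff_inv_smul_mem]
    simp only [mem_ofPred_eq, hinv s⁻¹ (S.inv_mem hs)]

section Haar

variable {G : Type*} [Group G] [TopologicalSpace G] [MeasurableSpace G] (μ : Measure G)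
  [μ.IsHaarMeasure]

/-- The measure by which left translation by `k⁻¹` moves the set `X`. -/
noncomputable def translationDefect (X : Set G) (k : G) : ℝ :=
  μ.real (((fun y => k * y) ⁻¹' X) ∆ X)

variable {μ} {X : Set G}

lemma translationDefect_eq_zero_iff [IsFiniteMeasure μ] {k : G} :
    translationDefect μ X k = 0 ↔ k ∈ MulAction.aestabilizer G μ X := by
  rw [translationDefect, measureReal_eq_zero_iff, measure_symmDiff_eq_zero_iff,
    ← inv_mem_iff (x := k), MulAction.mem_aestabilizer, ← Set.preimage_smul]
  rfl

lemma HasInvNhds.eq_top_of_ergodic [CompactSpace G] [T2Space G] [BorelSpace G]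
    [IsProbabilityMeasure μ] {A : Type*} [Group A] [MulDistribMulAction A G] {S : Subgroup A}
    {N : Subgroup G}
    (h : HasInvNhds S (N : Set G)) (hN : IsClosed (N : Set G))
    (herg : ∀ X : Set G, MeasurableSet X → (∀ s ∈ S, s • X = X) → μ X = 0 ∨ μ X = 1) :
    N = ⊤ := by
  refine (Subgroup.eq_top_iff' N).2 fun x => by_contra fun hx => ?_
  obtain ⟨U, U', hU, hU', hNU, hxU, hdisj⟩ := SeparatedNhds.of_isCompact_isCompact hN.isCompact
    (isCompact_singleton (x := x)) (Set.disjoint_singleton_right.2 hx)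
  obtain ⟨V, hV, hNV, hVU, hVS⟩ := h U hU hNU
  have hpos : 0 < μ V := hV.measure_pos μ ⟨1, hNV N.one_mem⟩
  have hpos' : 0 < μ U' := hU'.measure_pos μ ⟨x, hxU rfl⟩
  obtain h | h := herg V hV.measurableSet fun s hs => hVS hs
  · exact hpos.ne' h
  · rw [prob_compl_eq_zero_iff hV.measurableSet |>.symm] at h
    exact hpos'.ne' (measure_mono_null
      (fun y hy hyV => hdisj.le_bot ⟨hVU hyV, hy⟩) h)

variable [IsTopologicalGroup G] [CompactSpace G] [BorelSpace G]

lemma continuous_translationDefect [μ.InnerRegularCompactLTTop] [IsFiniteMeasure μ]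
    (hX : MeasurableSet X) : Continuous (translationDefect μ X) := by
  refine continuous_iff_continuousAt.2 fun k => ?_
  let f : G → C(G, G) := fun k => ⟨fun y => k * y, continuous_const_mul k⟩
  have hf : Continuous f := ContinuousMap.continuous_of_continuous_uncurry f continuous_mul
  have hlim := tendsto_measure_symmDiff_preimage_nhds_zero (μ := μ) (ν := μ) (s := X)
    (hf.tendsto k) (.of_forall fun a => measurePreserving_mul_left μ a)
    (measurePreserving_mul_left μ k) hX.nullMeasurableSet (measure_ne_top _ _)
  have hlim' := (ENNReal.tendsto_toReal ENNReal.zero_ne_top).comp hlim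
  rw [ENNReal.toReal_zero] at hlim'
  rw [ContinuousAt, tendsto_iff_dist_tendsto_zero]
  refine squeeze_zero (fun _ => dist_nonneg) (fun a => ?_) hlim'
  rw [Real.dist_eq, abs_sub_le_iff]
  have h₁ := measureReal_symmDiff_le (μ := μ) (s := f a ⁻¹' X) (t := f k ⁻¹' X) X
  have h₂ := measureReal_symmDiff_le (μ := μ) (s := f k ⁻¹' X) (t := f a ⁻¹' X) X
  rw [symmDiff_comm (f k ⁻¹' X) (f a ⁻¹' X)] at h₂
  exact ⟨sub_le_iff_le_add.2 h₁, sub_le_iff_le_add.2 h₂⟩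

variable {A : Type*} [Group A] [MulDistribMulAction A G] [ContinuousConstSMul A G]

lemma measurePreserving_smul_of_isHaarMeasure [IsFiniteMeasure μ] (a : A) :
    MeasurePreserving (fun x : G => a • x) μ μ :=
  MonoidHom.measurePreserving (f := MulDistribMulAction.toMonoidHom G a)
    (continuous_const_smul a) (MulAction.surjective a) rfl

lemma translationDefect_smul [IsFiniteMeasure μ] (hX : MeasurableSet X) {a : A}
    (ha : a • X = X) (k : G) : translationDefect μ X (a • k) = translationDefect μ X k := by
  have hmem : ∀ y, a • y ∈ X ↔ y ∈ X := fun y => by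
    conv_lhs => rw [← ha]
    exact Set.smul_mem_smul_set_iff
  have hm : MeasurableSet (((fun y => (a • k) * y) ⁻¹' X) ∆ X) :=
    (hX.preimage (measurable_const_mul _)).symmDiff hX
  rw [translationDefect, translationDefect,
    ← (measurePreserving_smul_of_isHaarMeasure (μ := μ) a).measureReal_preimage
      hm.nullMeasurableSet]
  congr 1
  ext y
  simp only [mem_preimage, mem_symmDiff, ← smul_mul', hmem]

lemma exists_normal_hasInvNhds [T2Space G] [SecondCountableTopology G]
    [IsProbabilityMeasure μ]
    {S : Subgroup A} (hX : MeasurableSet X) (hS : ∀ s ∈ S, s • X = X) (h0 : μ X ≠ 0)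
    (h1 : μ X ≠ 1) : ∃ N : Subgroup G, IsClosed (N : Set G) ∧ N.Normal ∧ N ≠ ⊤ ∧
      HasInvNhds S (N : Set G) := by
  have hcont := continuous_translationDefect (μ := μ) hX
  let Φ : G → C(G, ℝ) := fun k => ⟨fun x => translationDefect μ X (x * k * x⁻¹), by fun_prop⟩
  have hΦ : Continuous Φ := ContinuousMap.continuous_of_continuous_uncurry Φ
    (hcont.comp (by fun_prop : Continuous fun p : G × G => p.2 * p.1 * p.2⁻¹))
  have hle : ∀ s ∈ S, ∀ k, ‖Φ (s • k)‖ ≤ ‖Φ k‖ := fun s hs k => by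
    refine (ContinuousMap.norm_le _ (norm_nonneg _)).2 fun x => ?_
    have : Φ (s • k) x = Φ k (s⁻¹ • x) := by
      change translationDefect μ X (x * s • k * x⁻¹) =
        translationDefect μ X (s⁻¹ • x * k * (s⁻¹ • x)⁻¹)
      rw [← translationDefect_smul hX (hS s hs) (s⁻¹ • x * k * (s⁻¹ • x)⁻¹)]
      simp [smul_mul', smul_inv']
    rw [this]
    exact (Φ k).norm_coe_le_norm _
  have hN : {k | ‖Φ k‖ = 0} = ((MulAction.aestabilizer G μ X).normalCore : Set G) := by
    ext k
    simp only [mem_ofPred_eq, norm_eq_zero, SetLike.mem_coe, ContinuousMap.ext_iff]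
    exact forall_congr' fun x => translationDefect_eq_zero_iff
  refine ⟨(MulAction.aestabilizer G μ X).normalCore, ?_, inferInstance, fun htop => ?_, ?_⟩
  · rw [← hN]
    exact isClosed_eq hΦ.norm continuous_const
  · have hst : MulAction.aestabilizer G μ X = ⊤ :=
      top_unique (htop ▸ Subgroup.normalCore_le _)
    obtain h | h := Filter.eventuallyConst_set'.1
      (MulAction.aeconst_of_aestabilizer_eq_top (G := G) hX.nullMeasurableSet hst)
    · exact h0 (by simpa using measure_congr h)
    · exact h1 (by simpa using measure_congr h)
  · rw [← hN]
    refine hasInvNhds_zeroSet hΦ.norm (fun _ => norm_nonneg _) fun s hs k =>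
      (hle s hs k).antisymm ?_
    simpa using hle s⁻¹ (S.inv_mem hs) (s • k)

end Haar

section InfHasInvNhds

variable {D G : Type*} [Group D] [Group G] [TopologicalSpace G] [MulDistribMulAction D G]

/-- The intersection of all closed normal subgroups `N` such that `S` acts equicontinuously on the
quotient by `N`. -/
def infHasInvNhds (G : Type*) [Group G] [TopologicalSpace G] [MulDistribMulAction D G]
    (S : Subgroup D) : Subgroup G :=
  ⨅ i : {N : Subgroup G // IsClosed (N : Set G) ∧ N.Normal ∧ HasInvNhds S (N : Set G)}, i.1

lemma smul_infHasInvNhds {B : Type*} [Group B] [MulDistribMulAction B G]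
    [ContinuousConstSMul B G] {S : Subgroup D}
    (hB : ∀ b : B, ∀ s ∈ S, ∀ x : G, s • b • x = b • s • x) (b : B) :
    b • infHasInvNhds G S = infHasInvNhds G S := by
  have hle : ∀ b : B, b • infHasInvNhds G S ≤ infHasInvNhds G S := fun b => by
    refine le_iInf fun i => ?_
    rw [Subgroup.pointwise_smul_subset_iff]
    have hn := i.2.2.1
    refine iInf_le_of_le ⟨b⁻¹ • i.1, ?_, ⟨fun x hx y => ?_⟩, ?_⟩ le_rfl
    · rw [Subgroup.coe_pointwise_smul]
      exact i.2.1.smul _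
    · rw [Subgroup.mem_pointwise_smul_iff_inv_smul_mem] at hx ⊢
      simpa [smul_mul', smul_inv'] using hn.conj_mem _ hx (b • y)
    · rw [Subgroup.coe_pointwise_smul]
      exact i.2.2.2.smul_of_commute _ (hB _)
  refine (hle b).antisymm ?_
  rw [Subgroup.subset_pointwise_smul_iff]
  exact hle b⁻¹

lemma eq_top_of_closedInvariant {Z : Type*} [Group Z] [CompactSpace G] [T2Space G]
    [MulDistribMulAction Z G] [ContinuousConstSMul D G] [ContinuousConstSMul Z G]
    [SMulCommClass D Z G] (hcomm : ∀ a b : D, a * b = b * a) {S : Subgroup D}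
    (htop : ∀ N : Subgroup G, ClosedInvariant D Z N → HasInvNhds S (N : Set G) → N = ⊤)
    {N : Subgroup G} (hc : IsClosed (N : Set G)) (hn : N.Normal)
    (hinv : HasInvNhds S (N : Set G)) : N = ⊤ := by
  have htop' : infHasInvNhds G S = ⊤ := by
    refine htop _ ⟨?_, ?_, smul_infHasInvNhds fun b s _ x => ?_,
      smul_infHasInvNhds fun b s _ x => smul_comm _ _ _⟩ ?_
    · rw [infHasInvNhds, Subgroup.coe_iInf]
      exact isClosed_iInter fun i => i.2.1
    · exact Subgroup.normal_iInf_normal fun i => i.2.2.1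
    · rw [smul_smul, hcomm, smul_smul]
    · rw [infHasInvNhds, Subgroup.coe_iInf]
      exact HasInvNhds.iInter (fun i => i.2.2.2) fun i => i.2.1
  exact top_unique (htop' ▸ iInf_le_of_le ⟨N, hc, hn, hinv⟩ le_rfl)

end InfHasInvNhds

end Measure

section ContAut

open scoped Pointwise

variable [Group K] [TopologicalSpace K]

instance (H : Subgroup ↥(ContAut K)) : ContinuousConstSMul H K :=
  ⟨fun h => ContAut.continuous (h : ↥(ContAut K))⟩

instance (H : Subgroup ↥(ContAut K)) :
    SMulCommClass H (Subgroup.centralizer (H : Set ↥(ContAut K))) K :=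
  ⟨fun a z x => by
    have h : (a : ↥(ContAut K)) * z = z * a := Subgroup.mem_centralizer_iff.1 z.2 a a.2
    change ((a : ↥(ContAut K)) * (z : ↥(ContAut K))) • x = (z * (a : ↥(ContAut K))) • x
    rw [h]⟩

theorem exists_ergAut_of_dcc [IsTopologicalGroup K] [CompactSpace K] [T2Space K]
    [SecondCountableTopology K] [MeasurableSpace K] [BorelSpace K] (μ : Measure K)
    [μ.IsHaarMeasure] [IsProbabilityMeasure μ] (Δ : Subgroup ↥(ContAut K)) [Group.FG Δ]
    (hcomm : ∀ a b : Δ, a * b = b * a)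
    (hdcc : ∀ C : ℕ → Subgroup K, (∀ n, IsClosed (C n : Set K)) → Antitone C →
      (∀ n, ∀ z ∈ Subgroup.centralizer (Δ : Set ↥(ContAut K)), ∀ x ∈ C n,
        (z : MulAut K) x ∈ C n) → ∃ n, C (n + 1) = C n)
    (herg : ErgSet μ (Δ : Set ↥(ContAut K))) : ∃ d ∈ Δ, ErgAut μ d := by
  obtain ⟨a, ha⟩ := exists_zpowers_eq_top_of_hasInvNhds (D := Δ) (G := K)
    (Z := Subgroup.centralizer (Δ : Set ↥(ContAut K))) hcomm
    (fun C hC hanti => hdcc C (fun n => (hC n).isClosed) hanti fun n z hz x hx => by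
      have h := (hC n).smul_right ⟨z, hz⟩
      rw [← h]
      exact Subgroup.smul_mem_pointwise_smul x (⟨z, hz⟩ : Subgroup.centralizer _) _ hx)
    (fun N hN hinv => hinv.eq_top_of_ergodic (μ := μ) hN.isClosed fun X hX hs =>
      herg X hX fun d hd => hs ⟨d, hd⟩ (Subgroup.mem_top _))
  refine ⟨a, a.2, fun X hX hinv => ?_⟩
  by_contra! hne
  obtain ⟨N, hc, hn, hne, hN⟩ := exists_normal_hasInvNhds (μ := μ) (S := Subgroup.zpowers a) hX
    (by
      rintro _ ⟨n, rfl⟩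
      exact hinv _ ⟨n, rfl⟩) hne.1 hne.2
  exact hne (eq_top_of_closedInvariant hcomm ha hc hn hN)

lemma exists_eq_of_shiftDCC {Γ M : Type*} [Group Γ] [Group M] [TopologicalSpace M]
    (h : ShiftDCC Γ M) {K : Subgroup (Γ → M)} (hK : IsClosed (K : Set (Γ → M)))
    (hshift : ∀ γ : Γ, ∀ f : Γ → M, f ∈ K ↔ (shiftAut Γ M γ : MulAut (Γ → M)) f ∈ K)
    (C : ℕ → Subgroup K) (hC : ∀ n, IsClosed (C n : Set K)) (hanti : Antitone C)
    (hinv : ∀ n γ, ∀ x ∈ C n,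
      (restrictAut K (shiftAut Γ M γ) (hshift γ) : MulAut K) x ∈ C n) :
    ∃ n, C (n + 1) = C n := by
  obtain ⟨N, hN⟩ := h (fun n => (C n).map K.subtype)
    (fun n => by
      rw [Subgroup.coe_map]
      exact hK.isClosedEmbedding_subtypeVal.isClosedMap _ (hC n))
    (fun m n hmn => Subgroup.map_mono (hanti hmn))
    (by
      rintro n γ _ ⟨x, hx, rfl⟩
      refine ⟨_, hinv n γ⁻¹ x hx, ?_⟩
      funext β
      change (x : Γ → M) (γ⁻¹⁻¹ * β) = _
      rw [inv_inv]
      rfl)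
  exact ⟨N, Subgroup.map_injective K.subtype_injective (hN (N + 1) N.le_succ)⟩

end ContAut

/-- Theorem 4.7. Let `Γ` be a finitely generated abelian group, `M` a
compact Lie group (equivalently, a compact group admitting a faithful finite-dimensional
unitary representation), and `K` a closed shift-invariant subgroup of `M^Γ`. If `Δ` is a
finitely generated abelian group of continuous automorphisms of `K` commuting with the
shift action of `Γ` on `K` and `Δ` is ergodic on `K`, then some `d ∈ Δ` is ergodic. -/
theorem statement16 (Γ : Type*) [CommGroup Γ] [Group.FG Γ] [Countable Γ]
    (M : Type*) [Group M] [TopologicalSpace M] [IsTopologicalGroup M] [CompactSpace M]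
    [TopologicalSpace.MetrizableSpace M]
    (hLie : ∃ (k : ℕ) (φ : M →* Matrix.unitaryGroup (Fin k) ℂ),
      Continuous φ ∧ Function.Injective φ)
    (K : Subgroup (Γ → M)) (hK : IsClosed (K : Set (Γ → M)))
    (hshift : ∀ γ : Γ, ∀ f : Γ → M, f ∈ K ↔ (shiftAut Γ M γ : MulAut (Γ → M)) f ∈ K)
    [MeasurableSpace ↥K] [BorelSpace ↥K]
    (μ : Measure ↥K) [μ.IsHaarMeasure] [IsProbabilityMeasure μ]
    {m : ℕ} (δ : Fin m → ↥(ContAut ↥K))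
    (hcomm : ∀ i j, δ i * δ j = δ j * δ i)
    (Δ : Subgroup ↥(ContAut ↥K)) (hΔ : Δ = Subgroup.closure (Set.range δ))
    (hcommshift : ∀ d ∈ Δ, ∀ γ : Γ,
      d * restrictAut K (shiftAut Γ M γ) (hshift γ)
        = restrictAut K (shiftAut Γ M γ) (hshift γ) * d)
    (herg : ErgSet μ (Δ : Set ↥(ContAut ↥K))) :
    ∃ d ∈ Δ, ErgAut μ d := by
  obtain ⟨k, φ, hφ, hφinj⟩ := hLie
  obtain ⟨ρ, hρ, hρinj⟩ := exists_real_representation φ hφ hφinj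
  have hdcc : ShiftDCC Γ M := shiftDCC_of_fg fun C hC hanti =>
    closedSubgroup_dcc ρ hρ hρinj C hC hanti
  have : SecondCountableTopology M :=
    let _ : MetricSpace M := TopologicalSpace.metrizableSpaceMetric M
    inferInstance
  have : SecondCountableTopology K := TopologicalSpace.Subtype.secondCountableTopology _
  have : CompactSpace K := isCompact_iff_compactSpace.1 hK.isCompact
  have hcommΔ : ∀ a b : Δ, a * b = b * a := by
    have := Subgroup.isMulCommutative_closure (k := Set.range δ)
      (by rintro _ ⟨i, rfl⟩ _ ⟨j, rfl⟩; exact hcomm i j)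
    rw [← hΔ] at this
    exact fun a b => this.is_comm.comm a b
  have : Group.FG Δ := by
    rw [Group.fg_iff_subgroup_fg, Subgroup.fg_iff]
    exact ⟨Set.range δ, hΔ.symm, Set.finite_range δ⟩
  refine exists_ergAut_of_dcc μ Δ hcommΔ (fun C hC hanti hinv => ?_) herg
  exact exists_eq_of_shiftDCC hdcc hK hshift C hC hanti fun n γ x hx =>
    hinv n _ (Subgroup.mem_centralizer_iff.2 fun d hd => hcommshift d hd γ) x hx

end ErgZd
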